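/- Let H be an infinite dimensional complex Hilbert space and l ∈ ℕ with l ≥ 2. Then for every normal state φ₋ on B(H∧H) (viewed also on B(H⊗H) via B(H∧H) ≅ P₋B(H⊗H)P₋) one has the chain of inequalities (1/2)·q_{K^{⊗2}_l}(φ₋) ≤ q_{K^{∧2}_l}(φ₋) ≤ q_{K^{⊗2}_l}(φ₋). Moreover both bounds are attained: there exists a normal state φ₋ (e.g. the vector state of ξ_k = (1/√k)Σ_{i=1}^k e_i∧f_i with 1 ≤ k ≤ ⌊l/2⌋ and mutually orthogonal orthonormal systems {e_i}, {f_i}) with q_{K^{∧2}_l}(φ₋) = q_{K^{⊗2}_l}(φ₋) = 1, and there exists a normal state φ₋ (e.g. the vector state of ξ_l = (1/√l)Σ_{i=1}^l e_i∧f_i) with q_{K^{∧2}_l}(φ₋) = (1/2)·q_{K^{⊗2}_l}(φ₋) = 1. -/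

import Mathlib

noncomputable section

open scoped InnerProductSpace ENNReal Pointwise

/-- The vector functional `ω_{ξ,η}` on `B(H)` given by `x ↦ ⟨xξ, η⟩`
(linear in `x`; in Mathlib's convention this is `⟪η, x ξ⟫_ℂ`). -/
def omegaFunctional {H : Type*} [NormedAddCommGroup H] [InnerProductSpace ℂ H]
    (ξ η : H) : (H →L[ℂ] H) →L[ℂ] ℂ :=
  (innerSL ℂ η).comp (ContinuousLinearMap.apply ℂ H ξ)

/-- A continuous linear functional on `B(H)` is *normal* if it lies in the norm closure of the
linear span of the vector functionals (this is the predual `B(H)_*`, i.e. the trace-class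
induced functionals). -/
def IsNormalFunctional {H : Type*} [NormedAddCommGroup H] [InnerProductSpace ℂ H]
    (ψ : (H →L[ℂ] H) →L[ℂ] ℂ) : Prop :=
  ψ ∈ closure (Submodule.span ℂ {φ : (H →L[ℂ] H) →L[ℂ] ℂ | ∃ ξ η : H, φ = omegaFunctional ξ η} :
    Set ((H →L[ℂ] H) →L[ℂ] ℂ))

/-- A *normal state* on `B(H)`: a positive normal functional of norm one. -/
def IsNormalState {H : Type*} [NormedAddCommGroup H] [InnerProductSpace ℂ H] [CompleteSpace H]
    (φ : (H →L[ℂ] H) →L[ℂ] ℂ) : Prop :=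
  IsNormalFunctional φ ∧ ‖φ‖ = 1 ∧
    ∀ x : H →L[ℂ] H, x.IsPositive → 0 ≤ (φ x).re ∧ (φ x).im = 0

/-- `‖x‖_K := sup {|ψ(x)| : ψ ∈ K}`. -/
def normK {H : Type*} [NormedAddCommGroup H] [InnerProductSpace ℂ H]
    (K : Set ((H →L[ℂ] H) →L[ℂ] ℂ)) (x : H →L[ℂ] H) : ℝ :=
  sSup ((fun ψ : (H →L[ℂ] H) →L[ℂ] ℂ => ‖ψ x‖) '' K)

/-- The Minkowski functional `q_K(ψ) := inf {α ≥ 0 : ψ ∈ αK}`, with value `∞` if no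
such `α` exists. -/
def qK {H : Type*} [NormedAddCommGroup H] [InnerProductSpace ℂ H]
    (K : Set ((H →L[ℂ] H) →L[ℂ] ℂ)) (ψ : (H →L[ℂ] H) →L[ℂ] ℂ) : ℝ≥0∞ :=
  sInf {c : ℝ≥0∞ | ∃ r : ℝ, 0 ≤ r ∧ c = ENNReal.ofReal r ∧ ψ ∈ r • K}


/-- An abstract presentation of the `k`-fold Hilbert space tensor power `H^{⊗k}` of `H`,
realized on a Hilbert space `T`: a continuous multilinear map `tprod` (the elementary tensors
`η₁ ⊗ ... ⊗ η_k`) whose inner products multiply, whose range has dense linear span, together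
with the permutation unitaries `U_π` permuting the tensor factors. -/
structure HilbertTensorPower (k : ℕ) (H T : Type*) [NormedAddCommGroup H]
    [InnerProductSpace ℂ H] [NormedAddCommGroup T] [InnerProductSpace ℂ T] where
  tprod : ContinuousMultilinearMap ℂ (fun _ : Fin k => H) T
  inner_tprod : ∀ ξ η : Fin k → H, ⟪tprod ξ, tprod η⟫_ℂ = ∏ i, ⟪ξ i, η i⟫_ℂ
  span_dense : (Submodule.span ℂ (Set.range ⇑tprod)).topologicalClosure = ⊤
  U : Equiv.Perm (Fin k) → (T →L[ℂ] T)
  U_isometry : ∀ π, Isometry ⇑(U π)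
  U_surjective : ∀ π, Function.Surjective ⇑(U π)
  U_tprod : ∀ (π : Equiv.Perm (Fin k)) (ξ : Fin k → H),
    U π (tprod ξ) = tprod fun i => ξ (π i)

namespace HilbertTensorPower

variable {k : ℕ} {H T : Type*} [NormedAddCommGroup H] [InnerProductSpace ℂ H]
  [NormedAddCommGroup T] [InnerProductSpace ℂ T]

/-- The symmetrization projection `P₊ = (1/k!) Σ_π U_π`. -/
def Pplus (P : HilbertTensorPower k H T) : T →L[ℂ] T :=
  ((k.factorial : ℂ))⁻¹ • ∑ π : Equiv.Perm (Fin k), P.U π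

/-- The antisymmetrization projection `P₋ = (1/k!) Σ_π sign(π) U_π`. -/
def Pminus (P : HilbertTensorPower k H T) : T →L[ℂ] T :=
  ((k.factorial : ℂ))⁻¹ •
    ∑ π : Equiv.Perm (Fin k), (((Equiv.Perm.sign π : ℤ) : ℂ)) • P.U π

/-- The wedge product `η₁ ∧ ... ∧ η_k := √(k!) · P₋(η₁ ⊗ ... ⊗ η_k)`. -/
def wedge (P : HilbertTensorPower k H T) (η : Fin k → H) : T :=
  (Real.sqrt k.factorial : ℂ) • P.Pminus (P.tprod η)

/-- The set `V^{⊗k}` of unit product vectors. -/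
def prodVecs (P : HilbertTensorPower k H T) : Set T :=
  {ζ : T | ∃ η : Fin k → H, (∀ i, ‖η i‖ = 1) ∧ ζ = P.tprod η}

/-- The set `V^{∨k}` of symmetric unit product vectors `η ⊗ ... ⊗ η`. -/
def symVecs (P : HilbertTensorPower k H T) : Set T :=
  {ζ : T | ∃ η : H, ‖η‖ = 1 ∧ ζ = P.tprod fun _ => η}

/-- The set `V^{∧k}` of unit wedge (Slater) vectors. -/
def wedgeVecs (P : HilbertTensorPower k H T) : Set T :=
  {ζ : T | ∃ η : Fin k → H, ζ = P.wedge η ∧ ‖ζ‖ = 1}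

end HilbertTensorPower


section OmegaHull

variable {E : Type*} [NormedAddCommGroup E] [InnerProductSpace ℂ E]

@[simp]
lemma omegaFunctional_apply (ξ η : E) (x : E →L[ℂ] E) : omegaFunctional ξ η x = ⟪η, x ξ⟫_ℂ := rfl

/-- The norm-closed convex hull of the vector functionals `ω_{ξ,η}` with `ξ, η ∈ V`. -/
def omegaHull (V : Set E) : Set ((E →L[ℂ] E) →L[ℂ] ℂ) :=
  closure (convexHull ℝ
    {φ : (E →L[ℂ] E) →L[ℂ] ℂ | ∃ ξ ∈ V, ∃ η ∈ V, φ = omegaFunctional ξ η})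

/-- The unit vectors contained in a set `S`. -/
def unitVecs (S : Set E) : Set E := {ξ | ‖ξ‖ = 1 ∧ ξ ∈ S}

lemma convex_omegaHull (V : Set E) : Convex ℝ (omegaHull V) := (convex_convexHull ℝ _).closure

lemma isClosed_omegaHull (V : Set E) : IsClosed (omegaHull V) := isClosed_closure

lemma omegaFunctional_mem_omegaHull {V : Set E} {ξ η : E} (hξ : ξ ∈ V) (hη : η ∈ V) :
    omegaFunctional ξ η ∈ omegaHull V :=
  subset_closure (subset_convexHull ℝ _ ⟨ξ, hξ, η, hη, rfl⟩)

lemma omegaHull_subset {V : Set E} {C : Set ((E →L[ℂ] E) →L[ℂ] ℂ)} (hC : Convex ℝ C)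
    (hcl : IsClosed C) (h : ∀ ξ ∈ V, ∀ η ∈ V, omegaFunctional ξ η ∈ C) : omegaHull V ⊆ C := by
  refine closure_minimal (convexHull_min ?_ hC) hcl
  rintro _ ⟨ξ, hξ, η, hη, rfl⟩
  exact h ξ hξ η hη

lemma zero_mem_omegaHull {V : Set E} (hne : V.Nonempty) (hneg : ∀ ξ ∈ V, -ξ ∈ V) :
    0 ∈ omegaHull V := by
  obtain ⟨ξ, hξ⟩ := hne
  have h := convex_omegaHull V (omegaFunctional_mem_omegaHull hξ hξ)
    (omegaFunctional_mem_omegaHull hξ (hneg ξ hξ)) (a := 1 / 2) (b := 1 / 2)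
    (by norm_num) (by norm_num) (by norm_num)
  convert h using 1
  ext x
  simp

lemma smul_set_mono_of_zero_mem {F : Type*} [AddCommGroup F] [Module ℝ F] {K : Set F}
    (hK : Convex ℝ K) (h0 : (0 : F) ∈ K) {r s : ℝ} (hr : 0 ≤ r) (hrs : r ≤ s) :
    r • K ⊆ s • K := by
  rintro _ ⟨y, hy, rfl⟩
  rcases hr.eq_or_lt with rfl | hr
  · exact ⟨0, h0, by simp⟩
  · have hs : 0 < s := hr.trans_le hrs
    refine ⟨(r / s) • y, hK.smul_mem_of_zero_mem h0 hy ⟨by positivity, ?_⟩, ?_⟩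
    · exact (div_le_one hs).2 hrs
    · simp only [smul_smul]
      rw [mul_div_cancel₀ _ hs.ne']

lemma add_mem_add_smul {F : Type*} [AddCommGroup F] [Module ℝ F] {K : Set F}
    (hK : Convex ℝ K) {r s : ℝ} (hr : 0 ≤ r) (hs : 0 ≤ s) {x y : F}
    (hx : x ∈ r • K) (hy : y ∈ s • K) : x + y ∈ (r + s) • K := by
  rw [hK.add_smul hr hs]
  exact Set.add_mem_add hx hy

lemma zero_mem_omegaHull_unitVecs {S : Set E} (hS : ∀ (c : ℂ), ∀ ξ ∈ S, c • ξ ∈ S)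
    (hne : (unitVecs S).Nonempty) : 0 ∈ omegaHull (unitVecs S) := by
  refine zero_mem_omegaHull hne fun ξ hξ => ⟨by simpa using hξ.1, ?_⟩
  simpa using hS (-1) ξ hξ.2

lemma omegaFunctional_mem_smul_omegaHull {S : Set E} (hS : ∀ (c : ℂ), ∀ ξ ∈ S, c • ξ ∈ S)
    (hne : (unitVecs S).Nonempty)
    {ξ η : E} (hξ : ξ ∈ S) (hη : η ∈ S) :
    omegaFunctional ξ η ∈ (‖ξ‖ * ‖η‖) • omegaHull (unitVecs S) := by
  by_cases h : ξ = 0 ∨ η = 0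
  · refine ⟨0, zero_mem_omegaHull_unitVecs hS hne, ?_⟩
    ext x
    rcases h with rfl | rfl <;> simp
  · push Not at h
    have unit : ∀ ζ ∈ S, ζ ≠ 0 → ((‖ζ‖⁻¹ : ℝ) : ℂ) • ζ ∈ unitVecs S := fun ζ hζ h0 =>
      ⟨by simp [norm_smul, h0], hS _ _ hζ⟩
    refine ⟨_, omegaFunctional_mem_omegaHull (unit ξ hξ h.1) (unit η hη h.2), ?_⟩
    ext x
    have h1 : (‖ξ‖ : ℂ) ≠ 0 := by simpa using h.1
    have h2 : (‖η‖ : ℂ) ≠ 0 := by simpa using h.2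
    simp
    field_simp

lemma norm_omegaFunctional_le (ξ η : E) : ‖omegaFunctional ξ η‖ ≤ ‖ξ‖ * ‖η‖ := by
  refine ContinuousLinearMap.opNorm_le_bound _ (by positivity) fun x => ?_
  calc ‖⟪η, x ξ⟫_ℂ‖ ≤ ‖η‖ * ‖x ξ‖ := norm_inner_le_norm _ _
    _ ≤ ‖η‖ * (‖x‖ * ‖ξ‖) := by gcongr; exact x.le_opNorm ξ
    _ = ‖ξ‖ * ‖η‖ * ‖x‖ := by ring

lemma isNormalState_omegaFunctional [CompleteSpace E] {ξ : E} (hξ : ‖ξ‖ = 1) :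
    IsNormalState (omegaFunctional ξ ξ) := by
  refine ⟨subset_closure (Submodule.subset_span ⟨ξ, ξ, rfl⟩), le_antisymm ?_ ?_, fun x hx => ?_⟩
  · simpa [hξ] using norm_omegaFunctional_le ξ ξ
  · have h := (omegaFunctional ξ ξ).le_opNorm 1
    have hE : Nontrivial E := ⟨ξ, 0, by rintro rfl; simp at hξ⟩
    simpa [inner_self_eq_norm_sq_to_K, hξ] using h
  · have h := hx.inner_nonneg_right ξ
    rw [Complex.nonneg_iff] at h
    exact ⟨h.1, h.2.symm⟩

lemma qK_le_ofReal_mul_qK {K L : Set ((E →L[ℂ] E) →L[ℂ] ℂ)} {φ : (E →L[ℂ] E) →L[ℂ] ℂ} {c : ℝ}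
    (hc : 0 < c) (h : ∀ r : ℝ, 0 ≤ r → φ ∈ r • K → φ ∈ (c * r) • L) :
    qK L φ ≤ ENNReal.ofReal c * qK K φ := by
  rw [← ENNReal.div_le_iff' (by simp [hc]) ENNReal.ofReal_ne_top]
  refine le_sInf ?_
  rintro _ ⟨r, hr, rfl, hφ⟩
  rw [ENNReal.div_le_iff' (by simp [hc]) ENNReal.ofReal_ne_top]
  exact sInf_le ⟨c * r, by positivity, (ENNReal.ofReal_mul hc.le).symm, h r hr hφ⟩

lemma qK_le_ofReal {K : Set ((E →L[ℂ] E) →L[ℂ] ℂ)} {φ : (E →L[ℂ] E) →L[ℂ] ℂ} {r : ℝ}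
    (hr : 0 ≤ r) (h : φ ∈ r • K) : qK K φ ≤ ENNReal.ofReal r :=
  sInf_le ⟨r, hr, rfl, h⟩

lemma ofReal_le_qK_omegaHull {V : Set E} {φ : (E →L[ℂ] E) →L[ℂ] ℂ} {C : ℝ} {x : E →L[ℂ] E}
    (hx : ∀ ξ ∈ V, ∀ η ∈ V, C * ‖⟪η, x ξ⟫_ℂ‖ ≤ 1) (hφ : 1 ≤ ‖φ x‖) (hC : 0 < C) :
    ENNReal.ofReal C ≤ qK (omegaHull V) φ := by
  have hsub : omegaHull V ⊆ {ψ | ψ x ∈ Metric.closedBall (0 : ℂ) C⁻¹} := by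
    refine omegaHull_subset ?_ ?_ fun ξ hξ η hη => ?_
    · exact (convex_closedBall (0 : ℂ) C⁻¹).is_linear_preimage
        ⟨fun _ _ => rfl, fun _ _ => rfl⟩
    · exact Metric.isClosed_closedBall.preimage (ContinuousLinearMap.apply ℂ ℂ x).continuous
    · have := hx ξ hξ η hη
      simpa [le_inv_comm₀, ← one_div, le_div_iff₀' hC] using this
  refine le_sInf ?_
  rintro _ ⟨r, hr, rfl, ψ, hψ, rfl⟩
  refine ENNReal.ofReal_le_ofReal ?_
  have h1 : ‖ψ x‖ ≤ C⁻¹ := by simpa using hsub hψ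
  have h2 : ‖(r • ψ) x‖ = r * ‖ψ x‖ := by simp [abs_of_nonneg hr]
  have h3 : 1 ≤ r * C⁻¹ := calc
    1 ≤ ‖(r • ψ) x‖ := hφ
    _ ≤ r * C⁻¹ := by rw [h2]; gcongr
  rwa [← div_eq_mul_inv, one_le_div hC] at h3

end OmegaHull

section SumsOf

variable {E : Type*} [NormedAddCommGroup E]

/-- The vectors that are sums of `n` values of `f`. -/
def sumsOf {ι : Type*} (f : ι → E) (n : ℕ) : Set E := {ζ | ∃ η : Fin n → ι, ζ = ∑ i, f (η i)}

lemma sumsOf_mono {ι : Type*} {f : ι → E} (h0 : ∃ η, f η = 0) {m n : ℕ} (hmn : m ≤ n) :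
    sumsOf f m ⊆ sumsOf f n := by
  obtain ⟨k, rfl⟩ := Nat.exists_eq_add_of_le hmn
  obtain ⟨η₀, h0⟩ := h0
  rintro _ ⟨η, rfl⟩
  exact ⟨Fin.append η fun _ => η₀, by simp [Fin.sum_univ_add, h0]⟩

variable [InnerProductSpace ℂ E]

lemma smul_mem_sumsOf {ι : Type*} {f : ι → E} {n : ℕ} (hf : ∀ (c : ℂ) η, ∃ η', f η' = c • f η)
    (c : ℂ) {ζ : E} (hζ : ζ ∈ sumsOf f n) : c • ζ ∈ sumsOf f n := by
  obtain ⟨η, rfl⟩ := hζ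
  choose η' hη' using fun i => hf c (η i)
  exact ⟨η', by simp [hη', Finset.smul_sum]⟩

lemma setOf_linearCombination_eq {ι : Type*} {f : ι → E} {N : ι → Prop} {n : ℕ}
    (hf : ∀ (c : ℂ) η, ∃ η', f η' = c • f η) (hN : ∀ η, ∃ (c : ℂ) (η' : ι), N η' ∧ f η = c • f η') :
    {ξ : E | ‖ξ‖ = 1 ∧ ∃ (c : Fin n → ℂ) (η : Fin n → ι), (∀ i, N (η i)) ∧
      ξ = ∑ i, c i • f (η i)} = unitVecs (sumsOf f n) := by
  ext ξ
  refine and_congr_right fun _ => ⟨?_, ?_⟩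
  · rintro ⟨c, η, -, rfl⟩
    choose η' hη' using fun i => hf (c i) (η i)
    exact ⟨η', by simp [hη']⟩
  · rintro ⟨η, rfl⟩
    choose c η' h using fun i => hN (η i)
    exact ⟨c, η', fun i => (h i).1, Finset.sum_congr rfl fun i _ => (h i).2⟩

end SumsOf

namespace HilbertTensorPower

variable {H T : Type*} [NormedAddCommGroup H] [InnerProductSpace ℂ H]
  [NormedAddCommGroup T] [InnerProductSpace ℂ T]

section SwapOperator

variable (Q : HilbertTensorPower 2 H T)

lemma clm_ext {k : ℕ} (P : HilbertTensorPower k H T) {F : Type*} [NormedAddCommGroup F]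
    [NormedSpace ℂ F] {f g : T →L[ℂ] F}
    (h : ∀ η, f (P.tprod η) = g (P.tprod η)) : f = g := by
  refine ContinuousLinearMap.ext_on (s := Set.range P.tprod) ?_ ?_
  · rw [dense_iff_closure_eq, ← Submodule.topologicalClosure_coe, P.span_dense]
    rfl
  · rintro _ ⟨η, rfl⟩
    exact h η

lemma U_one_apply (x : T) : Q.U 1 x = x := by
  have h : Q.U 1 = ContinuousLinearMap.id ℂ T := Q.clm_ext fun η => by simp [Q.U_tprod]
  simp [h]

lemma U_swap_apply_apply (x : T) :
    Q.U (Equiv.swap 0 1) (Q.U (Equiv.swap 0 1) x) = x := by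
  have h : (Q.U (Equiv.swap 0 1)).comp (Q.U (Equiv.swap 0 1)) = ContinuousLinearMap.id ℂ T :=
    Q.clm_ext fun η => by simp [Q.U_tprod]
  exact congrArg (fun f => f x) h

lemma inner_U_U {k : ℕ} (P : HilbertTensorPower k H T) (π : Equiv.Perm (Fin k)) (x y : T) :
    ⟪P.U π x, P.U π y⟫_ℂ = ⟪x, y⟫_ℂ := by
  have h : ∀ x, ‖P.U π x‖ = ‖x‖ := fun x => by
    simpa using (P.U_isometry π).norm_map_of_map_zero (map_zero _) x
  exact (LinearMap.norm_map_iff_inner_map_map (P.U π)).1 h x y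

lemma inner_U_swap (x y : T) :
    ⟪Q.U (Equiv.swap 0 1) x, y⟫_ℂ = ⟪x, Q.U (Equiv.swap 0 1) y⟫_ℂ := by
  rw [← Q.inner_U_U (Equiv.swap 0 1) x, Q.U_swap_apply_apply]

lemma univ_perm_fin_two : (Finset.univ : Finset (Equiv.Perm (Fin 2))) = {1, Equiv.swap 0 1} := by
  decide

lemma Pminus_apply (x : T) :
    Q.Pminus x = (2 : ℂ)⁻¹ • (x - Q.U (Equiv.swap 0 1) x) := by
  have h : (1 : Equiv.Perm (Fin 2)) ≠ Equiv.swap 0 1 := by decide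
  simp [Pminus, univ_perm_fin_two, Finset.sum_pair h, Q.U_one_apply, sub_eq_add_neg]

lemma inner_Pminus (x y : T) : ⟪Q.Pminus x, y⟫_ℂ = ⟪x, Q.Pminus y⟫_ℂ := by
  rw [Q.Pminus_apply, Q.Pminus_apply, inner_smul_left, inner_smul_right, inner_sub_left,
    inner_sub_right, Q.inner_U_swap, map_inv₀, Complex.conj_ofNat]

lemma norm_Pminus_apply_le (x : T) : ‖Q.Pminus x‖ ≤ ‖x‖ := by
  have h : ‖Q.U (Equiv.swap 0 1) x‖ = ‖x‖ :=
    (Q.U_isometry _).norm_map_of_map_zero (map_zero _) x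
  have h2 := norm_sub_le x (Q.U (Equiv.swap 0 1) x)
  rw [Q.Pminus_apply, norm_smul, norm_inv, Complex.norm_ofNat]
  linarith

lemma Pminus_tprod (η : Fin 2 → H) :
    Q.Pminus (Q.tprod η) = (2 : ℂ)⁻¹ • (Q.tprod η - Q.tprod ![η 1, η 0]) := by
  have h : (fun i => η (Equiv.swap 0 1 i)) = ![η 1, η 0] := by
    ext i; fin_cases i <;> simp
  rw [Q.Pminus_apply, Q.U_tprod, h]

lemma wedge_eq (η : Fin 2 → H) :
    Q.wedge η = ((√2)⁻¹ : ℂ) • (Q.tprod η - Q.tprod ![η 1, η 0]) := by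
  rw [wedge, Q.Pminus_tprod, smul_smul]
  congr 1
  have h : ((√2 : ℝ) : ℂ) * (√2 : ℝ) = 2 := by
    rw [← Complex.ofReal_mul, Real.mul_self_sqrt (by norm_num)]; norm_num
  have h0 : ((√2 : ℝ) : ℂ) ≠ 0 := by simp
  simp only [Nat.factorial_two, Nat.cast_ofNat]
  field_simp
  linear_combination h

lemma tprod_smul_zero (c : ℂ) (η : Fin 2 → H) :
    Q.tprod ![c • η 0, η 1] = c • Q.tprod η := by
  have h := Q.tprod.map_update_smul η 0 c (η 0)
  rw [Function.update_eq_self] at h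
  rw [← h]
  congr 1
  ext i; fin_cases i <;> simp

lemma wedge_smul_zero (c : ℂ) (η : Fin 2 → H) :
    Q.wedge ![c • η 0, η 1] = c • Q.wedge η := by
  rw [wedge, Q.tprod_smul_zero, map_smul, wedge, smul_comm]

lemma inner_tprod_two (η ζ : Fin 2 → H) :
    ⟪Q.tprod η, Q.tprod ζ⟫_ℂ = ⟪η 0, ζ 0⟫_ℂ * ⟪η 1, ζ 1⟫_ℂ := by
  rw [Q.inner_tprod, Fin.prod_univ_two]

lemma norm_tprod_two (η : Fin 2 → H) : ‖Q.tprod η‖ = ‖η 0‖ * ‖η 1‖ := by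
  have h := Q.inner_tprod_two η η
  simp only [inner_self_eq_norm_sq_to_K] at h
  have h2 : ‖Q.tprod η‖ ^ 2 = (‖η 0‖ * ‖η 1‖) ^ 2 := by
    rw [mul_pow]; exact_mod_cast h
  exact (sq_eq_sq₀ (norm_nonneg _) (by positivity)).1 h2

end SwapOperator

section Rank

variable (Q : HilbertTensorPower 2 H T)

lemma exists_tprod_smul (c : ℂ) (η : Fin 2 → H) : ∃ η', Q.tprod η' = c • Q.tprod η :=
  ⟨_, Q.tprod_smul_zero c η⟩

lemma exists_wedge_smul (c : ℂ) (η : Fin 2 → H) : ∃ η', Q.wedge η' = c • Q.wedge η :=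
  ⟨_, Q.wedge_smul_zero c η⟩

lemma exists_tprod_normalize [Nontrivial H] (η : Fin 2 → H) :
    ∃ (c : ℂ) (η' : Fin 2 → H), (∀ j, ‖η' j‖ = 1) ∧ Q.tprod η = c • Q.tprod η' := by
  obtain ⟨u, hu⟩ := exists_norm_eq H zero_le_one
  by_cases h : η 0 = 0 ∨ η 1 = 0
  · refine ⟨0, fun _ => u, fun _ => hu, ?_⟩
    rw [zero_smul, ← norm_eq_zero, Q.norm_tprod_two]
    rcases h with h | h <;> simp [h]
  · push Not at h
    refine ⟨∏ i, (‖η i‖ : ℂ), fun i => ((‖η i‖⁻¹ : ℝ) : ℂ) • η i, ?_, ?_⟩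
    · intro j
      fin_cases j <;> simp [norm_smul, h.1, h.2]
    · rw [Q.tprod.map_smul_univ, smul_smul, ← Finset.prod_mul_distrib]
      have h1 : (‖η 0‖ : ℂ) ≠ 0 := by simpa using h.1
      have h2 : (‖η 1‖ : ℂ) ≠ 0 := by simpa using h.2
      simp [Fin.prod_univ_two, h1, h2]

lemma exists_wedge_normalize (h : ∃ η, ‖Q.wedge η‖ = 1) (η : Fin 2 → H) :
    ∃ (c : ℂ) (η' : Fin 2 → H), ‖Q.wedge η'‖ = 1 ∧ Q.wedge η = c • Q.wedge η' := by
  obtain ⟨η₀, h₀⟩ := h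
  by_cases hη : Q.wedge η = 0
  · exact ⟨0, η₀, h₀, by simp [hη]⟩
  · refine ⟨‖Q.wedge η‖, ![((‖Q.wedge η‖⁻¹ : ℝ) : ℂ) • η 0, η 1], ?_, ?_⟩
    · rw [Q.wedge_smul_zero, norm_smul]
      simp [hη]
    · rw [Q.wedge_smul_zero, smul_smul]
      simp [hη]

lemma tprod_zero : Q.tprod 0 = 0 := by
  rw [← norm_eq_zero, Q.norm_tprod_two]
  simp

lemma wedge_zero : Q.wedge 0 = 0 := by simp [wedge, Q.tprod_zero]

lemma sumsOf_wedge_subset (n : ℕ) : sumsOf Q.wedge n ⊆ sumsOf Q.tprod (n + n) := by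
  rintro _ ⟨η, rfl⟩
  choose a ha using fun i => Q.exists_tprod_smul ((√2)⁻¹ : ℂ) (η i)
  choose b hb using fun i => Q.exists_tprod_smul (-((√2)⁻¹ : ℂ)) ![η i 1, η i 0]
  refine ⟨Fin.append a b, ?_⟩
  rw [Fin.sum_univ_add, ← Finset.sum_add_distrib]
  refine Finset.sum_congr rfl fun i _ => ?_
  rw [Fin.append_left, Fin.append_right, ha, hb, Q.wedge_eq, smul_sub, neg_smul, sub_eq_add_neg]

lemma Pminus_mem_sumsOf_wedge {n : ℕ} {ζ : T} (hζ : ζ ∈ sumsOf Q.tprod n) :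
    Q.Pminus ζ ∈ sumsOf Q.wedge n := by
  obtain ⟨η, rfl⟩ := hζ
  choose a ha using fun i => Q.exists_wedge_smul ((√2)⁻¹ : ℂ) (η i)
  refine ⟨a, ?_⟩
  rw [map_sum]
  refine Finset.sum_congr rfl fun i _ => ?_
  rw [ha, wedge, smul_smul, Nat.factorial_two]
  simp

lemma Pminus_eq_self_of_mem_sumsOf_wedge {n : ℕ} {ζ : T} (hζ : ζ ∈ sumsOf Q.wedge n) :
    Q.Pminus ζ = ζ := by
  obtain ⟨η, rfl⟩ := hζ
  rw [map_sum]
  refine Finset.sum_congr rfl fun i _ => ?_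
  rw [wedge, map_smul]
  congr 1
  rw [Q.Pminus_apply (Q.Pminus _), Q.Pminus_apply, map_smul, map_sub, Q.U_swap_apply_apply]
  module

end Rank

section Decomposition

variable (Q : HilbertTensorPower 2 H T)

/-- The linear map `x ↦ x ⊗ y`. -/
def tprodLeft (y : H) : H →ₗ[ℂ] T := Q.tprod.toMultilinearMap.toLinearMap ![0, y] 0

/-- The linear map `y ↦ x ⊗ y`. -/
def tprodRight (x : H) : H →ₗ[ℂ] T := Q.tprod.toMultilinearMap.toLinearMap ![x, 0] 1

lemma tprodLeft_apply (x y : H) : Q.tprodLeft y x = Q.tprod ![x, y] := by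
  rw [tprodLeft, MultilinearMap.toLinearMap_apply]
  exact congrArg Q.tprod (by ext i; fin_cases i <;> simp)

lemma tprodRight_apply (x y : H) : Q.tprodRight x y = Q.tprod ![x, y] := by
  rw [tprodRight, MultilinearMap.toLinearMap_apply]
  exact congrArg Q.tprod (by ext i; fin_cases i <;> simp)

/-- A finite sequence of vectors lies in the span of an orthogonal sequence of the same length
whose members have norm one or vanish. -/
lemma _root_.exists_pairwise_orthogonal_expansion {n : ℕ} (f : Fin n → H) :
    ∃ a : Fin n → H, (Pairwise fun i j => ⟪a i, a j⟫_ℂ = 0) ∧ (∀ i, a i = 0 ∨ ‖a i‖ = 1) ∧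
      ∀ i, f i = ∑ j, ⟪a j, f i⟫_ℂ • a j := by
  set a := InnerProductSpace.gramSchmidtNormed ℂ f
  have horth : Pairwise fun i j => ⟪a i, a j⟫_ℂ = 0 := fun i j hij => by
    simp [a, InnerProductSpace.gramSchmidtNormed, InnerProductSpace.gramSchmidt_orthogonal ℂ f hij]
  have hnorm : ∀ i, a i = 0 ∨ ‖a i‖ = 1 := fun i =>
    or_iff_not_imp_left.2 fun h => InnerProductSpace.gramSchmidtNormed_unit_length' h
  refine ⟨a, horth, hnorm, fun i => ?_⟩
  have hmem : f i ∈ Submodule.span ℂ (Set.range a) := by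
    rw [InnerProductSpace.span_gramSchmidtNormed_range, InnerProductSpace.span_gramSchmidt]
    exact Submodule.subset_span ⟨i, rfl⟩
  generalize f i = x at hmem ⊢
  induction hmem using Submodule.span_induction with
  | mem x hx =>
    obtain ⟨k, rfl⟩ := hx
    rw [Finset.sum_eq_single k (fun j _ hj => by rw [horth hj, zero_smul]) (by simp)]
    rcases hnorm k with h | h <;> simp [h, inner_self_eq_norm_sq_to_K]
  | zero => simp
  | add x y _ _ hx hy =>
    simp only [inner_add_right, add_smul, Finset.sum_add_distrib]
    rw [← hx, ← hy]
  | smul c x _ hx =>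
    simp only [inner_smul_right, mul_smul, ← Finset.smul_sum]
    rw [← hx]

/-- A vector of Schmidt rank at most `n` can be written as `∑ i, a i ⊗ v i` with `a` orthogonal. -/
lemma exists_orthogonal_of_mem_sumsOf {n : ℕ} {ζ : T} (hζ : ζ ∈ sumsOf Q.tprod n) :
    ∃ a v : Fin n → H, (Pairwise fun i j => ⟪a i, a j⟫_ℂ = 0) ∧ (∀ i, ‖a i‖ ≤ 1) ∧
      ∑ i, ‖v i‖ ^ 2 = ‖ζ‖ ^ 2 ∧ ζ = ∑ i, Q.tprod ![a i, v i] := by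
  obtain ⟨η, rfl⟩ := hζ
  obtain ⟨a, horth, hnorm, hexp⟩ := exists_pairwise_orthogonal_expansion fun i => η i 0
  set v : Fin n → H := fun j => ∑ i, ⟪a j, η i 0⟫_ℂ • η i 1 with hv
  have hsum : ∑ i, Q.tprod (η i) = ∑ j, Q.tprod ![a j, v j] := by
    have h1 : ∀ j, Q.tprod ![a j, v j] = ∑ i, ⟪a j, η i 0⟫_ℂ • Q.tprod ![a j, η i 1] := by
      intro j
      simp only [← Q.tprodRight_apply, hv, map_sum, map_smul]
    have h2 : ∀ i, Q.tprod (η i) = ∑ j, ⟪a j, η i 0⟫_ℂ • Q.tprod ![a j, η i 1] := by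
      intro i
      have h3 : η i = ![η i 0, η i 1] := by ext k; fin_cases k <;> rfl
      simp only [← Q.tprodLeft_apply, ← map_smul, ← map_sum, ← hexp]
      rw [Q.tprodLeft_apply, ← h3]
    simp only [h1, h2]
    exact Finset.sum_comm
  refine ⟨a, v, horth, fun i => ?_, ?_, hsum⟩
  · rcases hnorm i with h | h <;> simp [h]
  · have hinner : ⟪∑ i, Q.tprod (η i), ∑ i, Q.tprod (η i)⟫_ℂ =
        ((∑ j, ‖v j‖ ^ 2 : ℝ) : ℂ) := by
      rw [hsum, sum_inner, Complex.ofReal_sum]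
      refine Finset.sum_congr rfl fun j _ => ?_
      rw [inner_sum, Finset.sum_eq_single j (fun k _ hk => by
        simp [Q.inner_tprod_two, horth hk.symm]) (by simp)]
      rw [Q.inner_tprod_two]
      rcases hnorm j with h | h
      · simp [h, hv]
      · simp [inner_self_eq_norm_sq_to_K, h]
    rw [← inner_self_eq_norm_sq (𝕜 := ℂ), hinner]
    exact (Complex.ofReal_re _).symm

lemma exists_orthogonal_add_of_mem_sumsOf {n : ℕ} {ζ : T} (hζ : ζ ∈ sumsOf Q.tprod (n + n)) :
    ∃ ζ₁ ∈ sumsOf Q.tprod n, ∃ ζ₂ ∈ sumsOf Q.tprod n, ζ = ζ₁ + ζ₂ ∧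
      ‖ζ₁‖ ^ 2 + ‖ζ₂‖ ^ 2 = ‖ζ‖ ^ 2 := by
  obtain ⟨a, v, horth, -, -, rfl⟩ := Q.exists_orthogonal_of_mem_sumsOf hζ
  refine ⟨_, ⟨fun i => ![a (Fin.castAdd n i), v (Fin.castAdd n i)], rfl⟩,
    _, ⟨fun i => ![a (Fin.natAdd n i), v (Fin.natAdd n i)], rfl⟩, Fin.sum_univ_add _, ?_⟩
  rw [Fin.sum_univ_add]
  simp only [pow_two]
  refine (norm_add_sq_eq_norm_sq_add_norm_sq_of_inner_eq_zero (𝕜 := ℂ) _ _ ?_).symm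
  rw [sum_inner]
  refine Finset.sum_eq_zero fun i _ => ?_
  rw [inner_sum]
  refine Finset.sum_eq_zero fun j _ => ?_
  have hij : Fin.castAdd n i ≠ Fin.natAdd n j := by
    intro h
    have := congrArg Fin.val h
    simp at this
    omega
  rw [Q.inner_tprod_two]
  simp only [Matrix.cons_val_zero, horth hij, zero_mul]

end Decomposition

section WedgeSum

variable (Q : HilbertTensorPower 2 H T) {n : ℕ} {p : Fin n ⊕ Fin n → H}

/-- The vector `n^{-1/2} ∑ i, p (inl i) ∧ p (inr i)`. -/
def normalizedWedgeSum (p : Fin n ⊕ Fin n → H) : T :=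
  ((√(n : ℝ))⁻¹ : ℂ) • ∑ i, Q.wedge ![p (.inl i), p (.inr i)]

lemma inner_tprod_wedge (η ζ : Fin 2 → H) : ⟪Q.tprod η, Q.wedge ζ⟫_ℂ =
    ((√2)⁻¹ : ℂ) * (⟪η 0, ζ 0⟫_ℂ * ⟪η 1, ζ 1⟫_ℂ - ⟪η 0, ζ 1⟫_ℂ * ⟪η 1, ζ 0⟫_ℂ) := by
  simp [Q.wedge_eq, Q.inner_tprod_two]

lemma inner_wedge_wedge (η ζ : Fin 2 → H) : ⟪Q.wedge η, Q.wedge ζ⟫_ℂ =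
    ⟪η 0, ζ 0⟫_ℂ * ⟪η 1, ζ 1⟫_ℂ - ⟪η 0, ζ 1⟫_ℂ * ⟪η 1, ζ 0⟫_ℂ := by
  have h : ((√2 : ℝ) : ℂ) * (√2 : ℝ) = 2 := by
    rw [← Complex.ofReal_mul, Real.mul_self_sqrt (by norm_num)]; norm_num
  have h0 : ((√2 : ℝ) : ℂ) ≠ 0 := by simp
  rw [Q.wedge_eq η, inner_smul_left, inner_sub_left, Q.inner_tprod_wedge, Q.inner_tprod_wedge]
  simp only [map_inv₀, Complex.conj_ofReal, Matrix.cons_val_zero, Matrix.cons_val_one]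
  field_simp
  linear_combination (⟪η 0, ζ 1⟫_ℂ * ⟪η 1, ζ 0⟫_ℂ - ⟪η 0, ζ 0⟫_ℂ * ⟪η 1, ζ 1⟫_ℂ) * h

lemma norm_normalizedWedgeSum (hn : n ≠ 0) (hp : Orthonormal ℂ p) :
    ‖Q.normalizedWedgeSum p‖ = 1 := by
  have hinner : ⟪∑ i, Q.wedge ![p (.inl i), p (.inr i)],
      ∑ i, Q.wedge ![p (.inl i), p (.inr i)]⟫_ℂ = n := by
    classical
    simp only [sum_inner, inner_sum, Q.inner_wedge_wedge, orthonormal_iff_ite.1 hp,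
      Matrix.cons_val_zero, Matrix.cons_val_one]
    simp
  have hsq : ‖∑ i, Q.wedge ![p (.inl i), p (.inr i)]‖ ^ 2 = n := by
    rw [← inner_self_eq_norm_sq (𝕜 := ℂ), hinner]
    simp
  have hnorm : ‖∑ i, Q.wedge ![p (.inl i), p (.inr i)]‖ = √n := by
    rw [← hsq, Real.sqrt_sq (norm_nonneg _)]
  have h0 : √(n : ℝ) ≠ 0 := by positivity
  rw [normalizedWedgeSum, norm_smul, hnorm]
  simp [abs_of_nonneg (Real.sqrt_nonneg _), h0]

lemma normalizedWedgeSum_mem (p : Fin n ⊕ Fin n → H) :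
    Q.normalizedWedgeSum p ∈ sumsOf Q.wedge n :=
  smul_mem_sumsOf Q.exists_wedge_smul _ ⟨_, rfl⟩

/-- Cauchy–Schwarz and Bessel for a permuted orthonormal family. -/
lemma _root_.Orthonormal.sum_norm_inner_mul_norm_inner_le {ι : Type*} [Fintype ι] {p : ι → H}
    (hp : Orthonormal ℂ p) (σ : Equiv.Perm ι) (a v : H) :
    ∑ j, ‖⟪a, p j⟫_ℂ‖ * ‖⟪v, p (σ j)⟫_ℂ‖ ≤ ‖a‖ * ‖v‖ := by
  have bessel : ∀ x : H, ∑ j, ‖⟪x, p j⟫_ℂ‖ ^ 2 ≤ ‖x‖ ^ 2 := fun x => by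
    simpa only [norm_inner_symm] using hp.sum_inner_products_le x (s := Finset.univ)
  have h := Finset.sum_mul_sq_le_sq_mul_sq Finset.univ (fun j => ‖⟪a, p j⟫_ℂ‖)
    (fun j => ‖⟪v, p (σ j)⟫_ℂ‖)
  rw [Equiv.sum_comp σ fun j => ‖⟪v, p j⟫_ℂ‖ ^ 2] at h
  refine abs_le_of_sq_le_sq' ?_ (by positivity) |>.2
  refine h.trans ?_
  rw [mul_pow]
  exact mul_le_mul (bessel a) (bessel v) (by positivity) (by positivity)

lemma norm_inner_tprod_sum_wedge_le (hp : Orthonormal ℂ p) (a v : H) :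
    ‖⟪Q.tprod ![a, v], ∑ i, Q.wedge ![p (.inl i), p (.inr i)]⟫_ℂ‖ ≤ (√2)⁻¹ * (‖a‖ * ‖v‖) := by
  have h := hp.sum_norm_inner_mul_norm_inner_le (Equiv.sumComm (Fin n) (Fin n)) a v
  rw [Fintype.sum_sum_type, ← Finset.sum_add_distrib] at h
  simp only [inner_sum, Q.inner_tprod_wedge, ← Finset.mul_sum]
  rw [norm_mul]
  have h2 : ‖((√2 : ℝ) : ℂ)⁻¹‖ = (√2)⁻¹ := by simp [abs_of_nonneg (Real.sqrt_nonneg _)]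
  rw [h2]
  gcongr
  refine ((norm_sum_le _ _).trans (Finset.sum_le_sum fun i _ => ?_)).trans h
  refine (norm_sub_le _ _).trans (le_of_eq ?_)
  simp

lemma norm_inner_normalizedWedgeSum_sq_le (hn : n ≠ 0) (hp : Orthonormal ℂ p) {ζ : T}
    (hζ : ζ ∈ sumsOf Q.tprod n) (hζ1 : ‖ζ‖ = 1) :
    ‖⟪ζ, Q.normalizedWedgeSum p⟫_ℂ‖ ^ 2 ≤ 1 / 2 := by
  obtain ⟨a, v, -, ha, hv, hζeq⟩ := Q.exists_orthogonal_of_mem_sumsOf hζ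
  rw [hζ1] at hv
  have h1 : ‖⟪ζ, ∑ i, Q.wedge ![p (.inl i), p (.inr i)]⟫_ℂ‖ ≤ (√2)⁻¹ * ∑ i, ‖v i‖ := by
    rw [hζeq, sum_inner, Finset.mul_sum]
    refine (norm_sum_le _ _).trans (Finset.sum_le_sum fun i _ => ?_)
    refine (Q.norm_inner_tprod_sum_wedge_le hp _ _).trans ?_
    gcongr
    exact mul_le_of_le_one_left (norm_nonneg _) (ha i)
  have h2 : (∑ i, ‖v i‖) ^ 2 ≤ n := by
    have := sq_sum_le_card_mul_sum_sq (s := Finset.univ) (f := fun i => ‖v i‖)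
    simpa [hv] using this
  have hn0 : (0 : ℝ) < n := by positivity
  rw [normalizedWedgeSum, inner_smul_right, norm_mul, mul_pow]
  have h3 : ‖((√(n : ℝ) : ℝ) : ℂ)⁻¹‖ ^ 2 = (n : ℝ)⁻¹ := by
    simp [Real.sq_sqrt hn0.le]
  rw [h3]
  calc (n : ℝ)⁻¹ * ‖⟪ζ, ∑ i, Q.wedge ![p (.inl i), p (.inr i)]⟫_ℂ‖ ^ 2
      ≤ (n : ℝ)⁻¹ * ((√2)⁻¹ * ∑ i, ‖v i‖) ^ 2 := by gcongr
    _ = (n : ℝ)⁻¹ * (1 / 2 * (∑ i, ‖v i‖) ^ 2) := by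
      rw [mul_pow, inv_pow, Real.sq_sqrt (by norm_num)]; ring
    _ ≤ (n : ℝ)⁻¹ * (1 / 2 * n) := by gcongr
    _ = 1 / 2 := by field_simp

end WedgeSum

end HilbertTensorPower

lemma exists_orthonormal_of_not_finiteDimensional {H : Type*} [NormedAddCommGroup H]
    [InnerProductSpace ℂ H] (hinf : ¬ FiniteDimensional ℂ H) (ι : Type*) [Finite ι] :
    ∃ p : ι → H, Orthonormal ℂ p := by
  let b := Module.Basis.ofVectorSpace ℂ H
  have hb : Infinite (Module.Basis.ofVectorSpaceIndex ℂ H) := by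
    by_contra h
    rw [not_infinite_iff_finite] at h
    exact hinf (Module.Finite.of_basis b)
  have e := Infinite.natEmbedding (Module.Basis.ofVectorSpaceIndex ℂ H)
  obtain ⟨m, ⟨σ⟩⟩ := Finite.exists_equiv_fin ι
  have hlin : LinearIndependent ℂ fun k : ℕ => b (e k) :=
    b.linearIndependent.comp e e.injective
  exact ⟨_, (InnerProductSpace.gramSchmidtNormed_orthonormal hlin).comp (fun i => (σ i : ℕ))
    (Fin.val_injective.comp σ.injective)⟩

/-- The vector state of a unit vector in `S` has Minkowski functional `1` with respect to the hull
of the unit vectors of `S`. -/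
lemma qK_omegaHull_unitVecs_eq_one {E : Type*} [NormedAddCommGroup E] [InnerProductSpace ℂ E]
    {S : Set E} {ξ : E} (hξ : ξ ∈ unitVecs S) :
    qK (omegaHull (unitVecs S)) (omegaFunctional ξ ξ) = 1 := by
  refine le_antisymm ?_ ?_
  · have h := qK_le_ofReal (r := 1) zero_le_one
      (by simpa using omegaFunctional_mem_omegaHull hξ hξ)
    simpa using h
  · have h := ofReal_le_qK_omegaHull (V := unitVecs S) (φ := omegaFunctional ξ ξ) (C := 1)
      (x := 1) (fun ζ hζ η hη => ?_) ?_ one_pos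
    · simpa using h
    · have := norm_inner_le_norm (𝕜 := ℂ) η ζ
      simpa [hζ.1, hη.1] using this
    · simp [inner_self_eq_norm_sq_to_K, hξ.1]

namespace HilbertTensorPower

variable {H T : Type*} [NormedAddCommGroup H] [InnerProductSpace ℂ H]
  [NormedAddCommGroup T] [InnerProductSpace ℂ T] (Q : HilbertTensorPower 2 H T) {l : ℕ}

lemma omegaFunctional_mem_two_smul (hne : (unitVecs (sumsOf Q.tprod l)).Nonempty) {ξ η : T}
    (hξ : ξ ∈ sumsOf Q.tprod (l + l)) (hη : η ∈ sumsOf Q.tprod (l + l))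
    (hξ1 : ‖ξ‖ = 1) (hη1 : ‖η‖ = 1) :
    omegaFunctional ξ η ∈ (2 : ℝ) • omegaHull (unitVecs (sumsOf Q.tprod l)) := by
  have hS : ∀ (c : ℂ), ∀ ζ ∈ sumsOf Q.tprod l, c • ζ ∈ sumsOf Q.tprod l := fun c ζ hζ =>
    smul_mem_sumsOf Q.exists_tprod_smul c hζ
  obtain ⟨ξ₁, hξ₁, ξ₂, hξ₂, rfl, hξn⟩ := Q.exists_orthogonal_add_of_mem_sumsOf hξ
  obtain ⟨η₁, hη₁, η₂, hη₂, rfl, hηn⟩ := Q.exists_orthogonal_add_of_mem_sumsOf hη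
  rw [hξ1] at hξn
  rw [hη1] at hηn
  have hK := convex_omegaHull (unitVecs (sumsOf Q.tprod l))
  have hω : omegaFunctional (ξ₁ + ξ₂) (η₁ + η₂) =
      (omegaFunctional ξ₁ η₁ + omegaFunctional ξ₁ η₂) +
        (omegaFunctional ξ₂ η₁ + omegaFunctional ξ₂ η₂) := by
    ext x
    simp
  rw [hω]
  refine smul_set_mono_of_zero_mem hK (zero_mem_omegaHull_unitVecs hS hne) ?_ ?_
    (add_mem_add_smul hK ?_ ?_
      (add_mem_add_smul hK ?_ ?_ (omegaFunctional_mem_smul_omegaHull hS hne hξ₁ hη₁)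
        (omegaFunctional_mem_smul_omegaHull hS hne hξ₁ hη₂))
      (add_mem_add_smul hK ?_ ?_ (omegaFunctional_mem_smul_omegaHull hS hne hξ₂ hη₁)
        (omegaFunctional_mem_smul_omegaHull hS hne hξ₂ hη₂)))
  all_goals try positivity
  nlinarith [sq_nonneg (‖ξ₁‖ - ‖η₁‖), sq_nonneg (‖ξ₁‖ - ‖η₂‖), sq_nonneg (‖ξ₂‖ - ‖η₁‖),
    sq_nonneg (‖ξ₂‖ - ‖η₂‖)]

lemma omegaHull_wedge_subset (hne : (unitVecs (sumsOf Q.tprod l)).Nonempty) :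
    omegaHull (unitVecs (sumsOf Q.wedge l)) ⊆
      (2 : ℝ) • omegaHull (unitVecs (sumsOf Q.tprod l)) :=
  omegaHull_subset ((convex_omegaHull _).smul 2) ((isClosed_omegaHull _).smul₀ (2 : ℝ))
    fun _ hξ _ hη => Q.omegaFunctional_mem_two_smul hne (Q.sumsOf_wedge_subset l hξ.2)
      (Q.sumsOf_wedge_subset l hη.2) hξ.1 hη.1

/-- Compression `x ↦ P₋ x P₋`. -/
def compress : (T →L[ℂ] T) →L[ℂ] (T →L[ℂ] T) :=
  (ContinuousLinearMap.compL ℂ T T T Q.Pminus).comp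
    ((ContinuousLinearMap.compL ℂ T T T).flip Q.Pminus)

lemma compress_apply (x : T →L[ℂ] T) : Q.compress x = Q.Pminus ∘L x ∘L Q.Pminus := rfl

lemma omegaFunctional_comp_compress (ξ η : T) :
    (omegaFunctional ξ η).comp Q.compress = omegaFunctional (Q.Pminus ξ) (Q.Pminus η) := by
  ext x
  simp [Q.compress_apply, Q.inner_Pminus]

lemma comp_compress_mem (hne : (unitVecs (sumsOf Q.wedge l)).Nonempty)
    {ψ : (T →L[ℂ] T) →L[ℂ] ℂ} (hψ : ψ ∈ omegaHull (unitVecs (sumsOf Q.tprod l))) :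
    ψ.comp Q.compress ∈ omegaHull (unitVecs (sumsOf Q.wedge l)) := by
  have hS : ∀ (c : ℂ), ∀ ζ ∈ sumsOf Q.wedge l, c • ζ ∈ sumsOf Q.wedge l := fun c ζ hζ =>
    smul_mem_sumsOf Q.exists_wedge_smul c hζ
  have hK := convex_omegaHull (unitVecs (sumsOf Q.wedge l))
  refine omegaHull_subset
    (C := {ψ | ψ.comp Q.compress ∈ omegaHull (unitVecs (sumsOf Q.wedge l))})
    ?_ ?_ (fun ξ hξ η hη => ?_) hψ
  · exact hK.is_linear_preimage ⟨fun _ _ => rfl, fun _ _ => rfl⟩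
  · exact (isClosed_omegaHull _).preimage
      ((ContinuousLinearMap.compL ℂ (T →L[ℂ] T) (T →L[ℂ] T) ℂ).flip Q.compress).continuous
  · rw [Set.mem_ofPred_eq, Q.omegaFunctional_comp_compress]
    have h := omegaFunctional_mem_smul_omegaHull hS hne (Q.Pminus_mem_sumsOf_wedge hξ.2)
      (Q.Pminus_mem_sumsOf_wedge hη.2)
    have h1 := Q.norm_Pminus_apply_le ξ
    have h2 := Q.norm_Pminus_apply_le η
    rw [hξ.1] at h1
    rw [hη.1] at h2
    simpa using smul_set_mono_of_zero_mem hK (zero_mem_omegaHull_unitVecs hS hne)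
      (by positivity) (mul_le_one₀ h1 (norm_nonneg _) h2) h

lemma omegaFunctional_compress_eq {n : ℕ} {ξ : T} (hξ : ξ ∈ sumsOf Q.wedge n)
    (x : T →L[ℂ] T) :
    omegaFunctional ξ ξ x = omegaFunctional ξ ξ (Q.Pminus ∘L x ∘L Q.Pminus) := by
  have h := Q.omegaFunctional_comp_compress ξ ξ
  rw [Q.Pminus_eq_self_of_mem_sumsOf_wedge hξ] at h
  exact congrArg (fun f => f x) h.symm

lemma two_le_qK_normalizedWedgeSum (hl : l ≠ 0) {p : Fin l ⊕ Fin l → H} (hp : Orthonormal ℂ p) :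
    2 ≤ qK (omegaHull (unitVecs (sumsOf Q.tprod l)))
      (omegaFunctional (Q.normalizedWedgeSum p) (Q.normalizedWedgeSum p)) := by
  set w := Q.normalizedWedgeSum p with hw
  have hw1 : ‖w‖ = 1 := Q.norm_normalizedWedgeSum hl hp
  have h := ofReal_le_qK_omegaHull (V := unitVecs (sumsOf Q.tprod l))
    (φ := omegaFunctional w w) (C := 2) (x := InnerProductSpace.rankOne ℂ w w)
    (fun ζ hζ η hη => ?_) ?_ two_pos
  · simpa using h
  · have h1 := Q.norm_inner_normalizedWedgeSum_sq_le hl hp hζ.2 hζ.1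
    have h2 := Q.norm_inner_normalizedWedgeSum_sq_le hl hp hη.2 hη.1
    rw [← hw] at h1 h2
    rw [InnerProductSpace.rankOne_apply, inner_smul_right, norm_mul, norm_inner_symm w ζ]
    nlinarith [sq_nonneg (‖⟪ζ, w⟫_ℂ‖ - ‖⟪η, w⟫_ℂ‖)]
  · simp [inner_self_eq_norm_sq_to_K, hw1]

end HilbertTensorPower

/-- For `H` infinite dimensional and `l ≥ 2`, every normal state `φ₋` on
`B(H ∧ H)` (viewed on `B(H ⊗ H)` via `φ₋(x) = φ₋(P₋xP₋)`) satisfies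
`(1/2)·q_{K^{⊗2}_l}(φ₋) ≤ q_{K^{∧2}_l}(φ₋) ≤ q_{K^{⊗2}_l}(φ₋)`, and both bounds are
attained: there is such a normal state with `q_{K^{∧2}_l} = q_{K^{⊗2}_l} = 1` and one with
`q_{K^{∧2}_l} = 1` and `q_{K^{⊗2}_l} = 2`. -/
theorem stmt19 {H T : Type*} [NormedAddCommGroup H] [InnerProductSpace ℂ H] [CompleteSpace H]
    [NormedAddCommGroup T] [InnerProductSpace ℂ T] [CompleteSpace T]
    (hinf : ¬ FiniteDimensional ℂ H)
    (l : ℕ) (hl : 2 ≤ l) (Q : HilbertTensorPower 2 H T)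
    (Vtl Vwl : Set T)
    (hVtl : Vtl = {ξ : T | ‖ξ‖ = 1 ∧ ∃ (c : Fin l → ℂ) (η : Fin l → Fin 2 → H),
      (∀ i j, ‖η i j‖ = 1) ∧ ξ = ∑ i, c i • Q.tprod (η i)})
    (hVwl : Vwl = {ξ : T | ‖ξ‖ = 1 ∧ ∃ (c : Fin l → ℂ) (η : Fin l → Fin 2 → H),
      (∀ i, ‖Q.wedge (η i)‖ = 1) ∧ ξ = ∑ i, c i • Q.wedge (η i)})
    (Ktl Kwl : Set ((T →L[ℂ] T) →L[ℂ] ℂ))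
    (hKtl : Ktl = closure (convexHull ℝ
      {φ : (T →L[ℂ] T) →L[ℂ] ℂ | ∃ ξ ∈ Vtl, ∃ η ∈ Vtl, φ = omegaFunctional ξ η}))
    (hKwl : Kwl = closure (convexHull ℝ
      {φ : (T →L[ℂ] T) →L[ℂ] ℂ | ∃ ξ ∈ Vwl, ∃ η ∈ Vwl, φ = omegaFunctional ξ η})) :
    (∀ φ : (T →L[ℂ] T) →L[ℂ] ℂ, IsNormalState φ →
      (∀ x : T →L[ℂ] T, φ x = φ (Q.Pminus ∘L x ∘L Q.Pminus)) →
      ENNReal.ofReal (1 / 2) * qK Ktl φ ≤ qK Kwl φ ∧ qK Kwl φ ≤ qK Ktl φ) ∧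
    (∃ φ : (T →L[ℂ] T) →L[ℂ] ℂ, IsNormalState φ ∧
      (∀ x : T →L[ℂ] T, φ x = φ (Q.Pminus ∘L x ∘L Q.Pminus)) ∧
      qK Kwl φ = 1 ∧ qK Ktl φ = 1) ∧
    (∃ φ : (T →L[ℂ] T) →L[ℂ] ℂ, IsNormalState φ ∧
      (∀ x : T →L[ℂ] T, φ x = φ (Q.Pminus ∘L x ∘L Q.Pminus)) ∧
      qK Kwl φ = 1 ∧ qK Ktl φ = 2) := by
  have hHnt : Nontrivial H := by
    by_contra h
    rw [not_nontrivial_iff_subsingleton] at h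
    exact hinf inferInstance
  have hl0 : l ≠ 0 := by omega
  obtain ⟨p, hp⟩ := exists_orthonormal_of_not_finiteDimensional hinf (Fin 1 ⊕ Fin 1)
  obtain ⟨q, hq⟩ := exists_orthonormal_of_not_finiteDimensional hinf (Fin l ⊕ Fin l)
  have hw1 := Q.norm_normalizedWedgeSum one_ne_zero hp
  have hwl := Q.norm_normalizedWedgeSum hl0 hq
  have hmem1 := Q.normalizedWedgeSum_mem p
  have hmeml := Q.normalizedWedgeSum_mem q
  set w := Q.normalizedWedgeSum p
  have hmemt : w ∈ unitVecs (sumsOf Q.tprod l) :=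
    ⟨hw1, sumsOf_mono ⟨0, Q.tprod_zero⟩ hl (Q.sumsOf_wedge_subset 1 hmem1)⟩
  have hmemw : w ∈ unitVecs (sumsOf Q.wedge l) :=
    ⟨hw1, sumsOf_mono ⟨0, Q.wedge_zero⟩ (by omega) hmem1⟩
  have hunit : ∃ η, ‖Q.wedge η‖ = 1 := by
    by_contra! h
    obtain ⟨η, hη⟩ := hmem1
    rw [Fin.sum_univ_one] at hη
    exact h (η 0) (hη ▸ hw1)
  have hVt : Vtl = unitVecs (sumsOf Q.tprod l) :=
    hVtl.trans (setOf_linearCombination_eq (N := fun η => ∀ j, ‖η j‖ = 1)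
      Q.exists_tprod_smul Q.exists_tprod_normalize)
  have hVw : Vwl = unitVecs (sumsOf Q.wedge l) :=
    hVwl.trans (setOf_linearCombination_eq
      Q.exists_wedge_smul (Q.exists_wedge_normalize hunit))
  have hKt : Ktl = omegaHull (unitVecs (sumsOf Q.tprod l)) := by
    rw [hKtl, hVt]; rfl
  have hKw : Kwl = omegaHull (unitVecs (sumsOf Q.wedge l)) := by
    rw [hKwl, hVw]; rfl
  clear hVtl hVwl hKtl hKwl hVt hVw
  subst hKt hKw
  have hlower : ∀ φ : (T →L[ℂ] T) →L[ℂ] ℂ,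
      qK (omegaHull (unitVecs (sumsOf Q.tprod l))) φ ≤
        ENNReal.ofReal 2 * qK (omegaHull (unitVecs (sumsOf Q.wedge l))) φ := by
    refine fun φ => qK_le_ofReal_mul_qK two_pos fun r hr hφ => ?_
    rw [mul_comm, mul_smul]
    exact Set.smul_set_mono (Q.omegaHull_wedge_subset ⟨w, hmemt⟩) hφ
  refine ⟨fun φ _ hφ => ⟨?_, ?_⟩, ?_, ?_⟩
  · calc ENNReal.ofReal (1 / 2) * _ ≤ ENNReal.ofReal (1 / 2) * (ENNReal.ofReal 2 * _) := by
          gcongr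
          exact hlower φ
      _ = _ := by
          rw [← mul_assoc, ← ENNReal.ofReal_mul (by norm_num)]
          norm_num
  · have h := qK_le_ofReal_mul_qK (K := omegaHull (unitVecs (sumsOf Q.tprod l)))
      (L := omegaHull (unitVecs (sumsOf Q.wedge l))) (φ := φ) one_pos
      fun r hr ⟨ψ, hψ, hψφ⟩ => ?_
    · simpa using h
    · refine ⟨_, Q.comp_compress_mem ⟨w, hmemw⟩ hψ, ?_⟩
      ext x
      rw [hφ x, ← hψφ, one_mul]
      rfl
  · exact ⟨omegaFunctional w w, isNormalState_omegaFunctional hw1,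
      Q.omegaFunctional_compress_eq hmem1, qK_omegaHull_unitVecs_eq_one hmemw,
      qK_omegaHull_unitVecs_eq_one hmemt⟩
  · have h1 := qK_omegaHull_unitVecs_eq_one (S := sumsOf Q.wedge l)
      ⟨hwl, hmeml⟩
    refine ⟨_, isNormalState_omegaFunctional hwl, Q.omegaFunctional_compress_eq hmeml, h1,
      le_antisymm ?_ (Q.two_le_qK_normalizedWedgeSum hl0 hq)⟩
    have h2 := hlower (omegaFunctional (Q.normalizedWedgeSum q) (Q.normalizedWedgeSum q))
    rw [h1] at h2
    simpa using h2
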